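/- Let m ≥ 1 be an integer. For every ε > 0 there exists a constant c > 0, depending only on m and ε, such that for every smooth periodic function u : ℝ² → ℝ, ‖A^{m+1}u‖ · ‖A^{m−1}(u³)‖ ≤ ε ‖A^{m+1}u‖² + c(‖u‖^{2(2m+3)} + 1). -/

import Mathlib

open MeasureTheory Real Filter

noncomputable section

/-- A function `u : ℝ² → ℝ` is smooth periodic if it is `C^∞` and `2π`-periodic
in each variable. -/
def SmoothPeriodic (u : ℝ × ℝ → ℝ) : Prop :=
  ContDiff ℝ (⊤ : ℕ∞) u ∧ (∀ x y, u (x + 2 * Real.pi, y) = u (x, y)) ∧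
    (∀ x y, u (x, y + 2 * Real.pi) = u (x, y))

/-- Partial derivative in the first variable. -/
def pdx (u : ℝ × ℝ → ℝ) : ℝ × ℝ → ℝ := fun p => fderiv ℝ u p (1, 0)

/-- Partial derivative in the second variable. -/
def pdy (u : ℝ × ℝ → ℝ) : ℝ × ℝ → ℝ := fun p => fderiv ℝ u p (0, 1)

/-- The fundamental domain `[0, 2π]²`. -/
def sq2 : Set (ℝ × ℝ) := Set.Icc (0 : ℝ) (2 * Real.pi) ×ˢ Set.Icc (0 : ℝ) (2 * Real.pi)

/-- The `L²` inner product over `[0, 2π]²`. -/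
def l2inner (u v : ℝ × ℝ → ℝ) : ℝ := ∫ p in sq2, u p * v p

/-- The `L²` norm over `[0, 2π]²`. -/
def l2norm (u : ℝ × ℝ → ℝ) : ℝ := Real.sqrt (∫ p in sq2, (u p) ^ 2)

/-- The `L^q` norm over `[0, 2π]²`. -/
def lpnorm (q : ℝ) (u : ℝ × ℝ → ℝ) : ℝ := (∫ p in sq2, |u p| ^ q) ^ (1 / q)

/-- The operator `A = -Δ + 1`. -/
def Aop (u : ℝ × ℝ → ℝ) : ℝ × ℝ → ℝ :=
  fun p => -(pdx (pdx u) p + pdy (pdy u) p) + u p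

/-- The pointwise dot product of gradients, `∇v ⋅ ∇w`. -/
def gradDot (v w : ℝ × ℝ → ℝ) : ℝ × ℝ → ℝ :=
  fun p => pdx v p * pdx w p + pdy v p * pdy w p

/-- The nonlinearity `f(u) = (a+3)u − 4Au + b|∇u|² + u³`. -/
def fNL (a b : ℝ) (u : ℝ × ℝ → ℝ) : ℝ × ℝ → ℝ :=
  fun p => (a + 3) * u p - 4 * Aop u p + b * gradDot u u p + (u p) ^ 3

open scoped ENNReal

/-! ### Sums of extended nonnegative reals -/

/-- A weighted form of the Cauchy–Schwarz inequality. -/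
theorem sq_tsum_le_tsum_mul_tsum {ι : Type*} {a b c : ι → ℝ≥0∞}
    (h : ∀ i, c i ^ 2 ≤ a i * b i) : (∑' i, c i) ^ 2 ≤ (∑' i, a i) * ∑' i, b i := by
  let : MeasurableSpace ι := ⊤
  have hc (i : ι) : c i ≤ a i ^ (1 / 2 : ℝ) * b i ^ (1 / 2 : ℝ) := by
    rw [← ENNReal.mul_rpow_of_nonneg _ _ (by norm_num)]
    refine le_trans (le_of_eq ?_) (ENNReal.rpow_le_rpow (h i) (by norm_num : (0 : ℝ) ≤ 1 / 2))
    rw [← ENNReal.rpow_natCast, ← ENNReal.rpow_mul]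
    norm_num
  have key := ENNReal.lintegral_mul_norm_pow_le (μ := Measure.count) (f := a) (g := b)
    (measurable_from_top.aemeasurable) (measurable_from_top.aemeasurable)
    (p := 1 / 2) (q := 1 / 2) (by norm_num) (by norm_num) (by norm_num)
  simp only [lintegral_count] at key
  calc (∑' i, c i) ^ 2
      ≤ ((∑' i, a i) ^ (1 / 2 : ℝ) * (∑' i, b i) ^ (1 / 2 : ℝ)) ^ 2 :=
        pow_le_pow_left' ((ENNReal.tsum_le_tsum hc).trans key) 2
    _ = (∑' i, a i) * ∑' i, b i := by
        rw [mul_pow, ← ENNReal.rpow_natCast, ← ENNReal.rpow_natCast, ← ENNReal.rpow_mul,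
          ← ENNReal.rpow_mul]
        norm_num

/-- Discrete convolution. -/
def conv {G : Type*} [AddCommGroup G] (a b : G → ℝ≥0∞) (n : G) : ℝ≥0∞ :=
  ∑' j, a j * b (n - j)

section Convolution

variable {G : Type*} [AddCommGroup G]

theorem conv_comm (a b : G → ℝ≥0∞) : conv a b = conv b a := by
  funext n
  unfold conv
  rw [← (Equiv.subLeft n).tsum_eq]
  refine tsum_congr fun j => ?_
  simp [mul_comm]

theorem tsum_conv (a b : G → ℝ≥0∞) : ∑' n, conv a b n = (∑' j, a j) * ∑' j, b j := by
  unfold conv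
  rw [ENNReal.tsum_comm, ← ENNReal.tsum_mul_right]
  refine tsum_congr fun j => ?_
  rw [ENNReal.tsum_mul_left]
  congr 1
  exact (Equiv.subRight j).tsum_eq b

/-- Young's inequality `ℓ¹ * ℓ² ⊆ ℓ²`. -/
theorem tsum_conv_sq_le (a b : G → ℝ≥0∞) :
    ∑' n, conv a b n ^ 2 ≤ (∑' j, a j) ^ 2 * ∑' j, b j ^ 2 := by
  have h (n : G) : conv a b n ^ 2 ≤ (∑' j, a j) * conv a (fun k => b k ^ 2) n :=
    sq_tsum_le_tsum_mul_tsum fun j => le_of_eq (by ring)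
  calc ∑' n, conv a b n ^ 2 ≤ ∑' n, (∑' j, a j) * conv a (fun k => b k ^ 2) n :=
        ENNReal.tsum_le_tsum h
    _ = (∑' j, a j) ^ 2 * ∑' j, b j ^ 2 := by
        rw [ENNReal.tsum_mul_left, tsum_conv]; ring

theorem ENNReal.add_sq_le (a b : ℝ≥0∞) : (a + b) ^ 2 ≤ 2 * (a ^ 2 + b ^ 2) := by
  have := ENNReal.rpow_add_le_mul_rpow_add_rpow a b (p := 2) (by norm_num)
  norm_num at this
  exact_mod_cast this

theorem ENNReal.add_pow_le_two_pow_mul (a b : ℝ≥0∞) (p : ℕ) :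
    (a + b) ^ p ≤ 2 ^ p * (a ^ p + b ^ p) := by
  rcases le_total a b with h | h
  · calc (a + b) ^ p ≤ (2 * b) ^ p := by rw [two_mul]; gcongr
      _ = 2 ^ p * b ^ p := mul_pow _ _ _
      _ ≤ _ := by gcongr; exact le_add_self
  · calc (a + b) ^ p ≤ (2 * a) ^ p := by rw [two_mul]; gcongr
      _ = 2 ^ p * a ^ p := mul_pow _ _ _
      _ ≤ _ := by gcongr; exact le_self_add

/-- A Leibniz-type rule: a quasi-subadditive weight can be distributed over the factors of a
convolution. -/
theorem tsum_weight_conv_sq_le {w : G → ℝ≥0∞} (hw : ∀ j k, w (j + k) ≤ 2 * (w j + w k)) (p : ℕ)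
    {a b c : G → ℝ≥0∞} (hc : ∀ n, c n ≤ conv a b n) :
    ∑' n, (w n ^ p * c n) ^ 2 ≤ (2 * (4 ^ p) ^ 2) *
      ((∑' n, (w n ^ p * a n) ^ 2) * (∑' n, b n) ^ 2 +
        (∑' n, a n) ^ 2 * ∑' n, (w n ^ p * b n) ^ 2) := by
  have hwp (n j : G) : w n ^ p ≤ 4 ^ p * (w j ^ p + w (n - j) ^ p) := by
    calc w n ^ p ≤ (2 * (w j + w (n - j))) ^ p := by
          gcongr
          simpa using hw j (n - j)
      _ = 2 ^ p * (w j + w (n - j)) ^ p := mul_pow _ _ _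
      _ ≤ 2 ^ p * (2 ^ p * (w j ^ p + w (n - j) ^ p)) := by
          gcongr
          exact ENNReal.add_pow_le_two_pow_mul _ _ _
      _ = 4 ^ p * (w j ^ p + w (n - j) ^ p) := by
          rw [← mul_assoc, ← mul_pow]
          norm_num
  have hpt (n : G) : w n ^ p * c n ≤
      4 ^ p * (conv b (fun k => w k ^ p * a k) n + conv a (fun k => w k ^ p * b k) n) := by
    calc w n ^ p * c n ≤ w n ^ p * conv a b n := by gcongr; exact hc n
      _ = ∑' j, w n ^ p * (a j * b (n - j)) := by rw [conv, ENNReal.tsum_mul_left]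
      _ ≤ ∑' j, 4 ^ p * (w j ^ p * a j * b (n - j) + a j * (w (n - j) ^ p * b (n - j))) := by
          refine ENNReal.tsum_le_tsum fun j => ?_
          calc w n ^ p * (a j * b (n - j))
              ≤ 4 ^ p * (w j ^ p + w (n - j) ^ p) * (a j * b (n - j)) := by
                gcongr; exact hwp n j
            _ = _ := by ring
      _ = _ := by
          rw [ENNReal.tsum_mul_left, ENNReal.tsum_add, conv_comm b]
          rfl
  calc ∑' n, (w n ^ p * c n) ^ 2
      ≤ ∑' n, (2 * (4 ^ p) ^ 2) * (conv b (fun k => w k ^ p * a k) n ^ 2 +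
          conv a (fun k => w k ^ p * b k) n ^ 2) := by
        refine ENNReal.tsum_le_tsum fun n => ?_
        refine (pow_le_pow_left' (hpt n) 2).trans ?_
        rw [mul_pow, mul_comm 2, mul_assoc]
        gcongr
        exact ENNReal.add_sq_le _ _
    _ ≤ _ := by
        rw [ENNReal.tsum_mul_left, ENNReal.tsum_add]
        gcongr
        · rw [mul_comm]; exact tsum_conv_sq_le _ _
        · exact tsum_conv_sq_le _ _

end Convolution

/-! ### A lattice sum -/

theorem sum_range_inv_sq_add_sq_le {μ : ℝ} (hμ : 1 ≤ μ) (n : ℕ) :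
    ∑ i ∈ Finset.range n, 1 / (μ ^ 2 + (i : ℝ) ^ 2) ≤ 4 * (1 / μ - 1 / (μ + n)) := by
  induction n with
  | zero => simp
  | succ n ih =>
    rw [Finset.sum_range_succ]
    have hn : (0 : ℝ) ≤ n := n.cast_nonneg
    have : 1 / (μ ^ 2 + (n : ℝ) ^ 2) ≤ 4 * (1 / (μ + n) - 1 / (μ + (n + 1 : ℕ))) := by
      have h : 4 * (1 / (μ + n) - 1 / (μ + (n + 1 : ℕ))) =
          4 / ((μ + n) * (μ + (n + 1 : ℕ))) := by
        push_cast
        field_simp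
        ring
      rw [h, div_le_div_iff₀ (by positivity) (by positivity)]
      push_cast
      nlinarith [sq_nonneg (μ - n)]
    linarith

theorem tsum_int_inv_sq_add_sq_le {μ : ℝ} (hμ : 1 ≤ μ) :
    ∑' n : ℤ, ENNReal.ofReal (1 / (μ ^ 2 + (n : ℝ) ^ 2)) ≤ ENNReal.ofReal (8 / μ) := by
  have hsum (n : ℕ) : ∑ i ∈ Finset.range n, 1 / (μ ^ 2 + (i : ℝ) ^ 2) ≤ 4 / μ := by
    refine (sum_range_inv_sq_add_sq_le hμ n).trans ?_
    have : 0 ≤ 1 / (μ + n) := by positivity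
    have h4 : 4 / μ = 4 * (1 / μ) := by ring
    linarith
  have hnat : ∑' n : ℕ, ENNReal.ofReal (1 / (μ ^ 2 + (n : ℝ) ^ 2)) ≤ ENNReal.ofReal (4 / μ) := by
    refine ENNReal.tsum_le_of_sum_range_le fun n => ?_
    rw [← ENNReal.ofReal_sum_of_nonneg fun i _ => by positivity]
    exact ENNReal.ofReal_le_ofReal (hsum n)
  have hneg : ∑' n : ℕ, ENNReal.ofReal (1 / (μ ^ 2 + ((-((n : ℤ) + 1) : ℤ) : ℝ) ^ 2)) ≤
      ENNReal.ofReal (4 / μ) := by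
    refine le_trans (ENNReal.tsum_le_tsum fun n => ENNReal.ofReal_le_ofReal ?_) hnat
    push_cast
    have hn : (0 : ℝ) ≤ n := n.cast_nonneg
    gcongr 1 / (_ + ?_)
    nlinarith
  rw [tsum_of_nat_of_neg_add_one ENNReal.summable ENNReal.summable,
    show 8 / μ = 4 / μ + 4 / μ by ring, ENNReal.ofReal_add (by positivity) (by positivity)]
  exact add_le_add (by simpa using hnat) hneg

/-- The symbol of the operator `A`. -/
def symb (k : Fin 2 → ℤ) : ℝ := 1 + (k 0 : ℝ) ^ 2 + (k 1 : ℝ) ^ 2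

theorem one_le_symb (k : Fin 2 → ℤ) : 1 ≤ symb k := by
  unfold symb
  nlinarith [sq_nonneg (k 0 : ℝ), sq_nonneg (k 1 : ℝ)]

theorem symb_add_le (j k : Fin 2 → ℤ) : symb (j + k) ≤ 2 * (symb j + symb k) := by
  simp only [symb, Pi.add_apply, Int.cast_add]
  nlinarith [sq_nonneg ((j 0 : ℝ) - k 0), sq_nonneg ((j 1 : ℝ) - k 1)]

theorem tsum_inv_sq_add_symb_sq_le {μ : ℝ} (hμ : 1 ≤ μ) :
    ∑' k, ENNReal.ofReal (1 / ((μ ^ 2) ^ 2 + symb k ^ 2)) ≤ ENNReal.ofReal (128 / μ ^ 2) := by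
  set f : ℤ → ℝ≥0∞ := fun n => ENNReal.ofReal (1 / (μ ^ 2 + (n : ℝ) ^ 2)) with hf
  have hpt (k : Fin 2 → ℤ) : ENNReal.ofReal (1 / ((μ ^ 2) ^ 2 + symb k ^ 2)) ≤
      2 * (f (k 0) * f (k 1)) := by
    rw [hf, show (2 : ℝ≥0∞) = ENNReal.ofReal 2 by simp]
    rw [← ENNReal.ofReal_mul (by positivity), ← ENNReal.ofReal_mul (by positivity)]
    refine ENNReal.ofReal_le_ofReal ?_
    rw [div_mul_div_comm, mul_div_assoc', div_le_div_iff₀ (by positivity) (by positivity)]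
    unfold symb
    have h0 := sq_nonneg (k 0 : ℝ)
    have h1 := sq_nonneg (k 1 : ℝ)
    have h2 := sq_nonneg μ
    generalize (k 0 : ℝ) ^ 2 = x at *
    generalize (k 1 : ℝ) ^ 2 = y at *
    generalize μ ^ 2 = t at *
    nlinarith [sq_nonneg (t - (x + y)), mul_nonneg h0 h1, sq_nonneg (x - y)]
  calc _ ≤ ∑' k : Fin 2 → ℤ, 2 * (f (k 0) * f (k 1)) := ENNReal.tsum_le_tsum hpt
    _ = 2 * ∑' q : ℤ × ℤ, f q.1 * f q.2 := by
        rw [ENNReal.tsum_mul_left, ← (finTwoArrowEquiv ℤ).tsum_eq]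
        rfl
    _ = 2 * ((∑' n, f n) * ∑' n, f n) := by
        rw [ENNReal.tsum_prod']
        simp_rw [ENNReal.tsum_mul_left, ENNReal.tsum_mul_right]
    _ ≤ ENNReal.ofReal 2 * (ENNReal.ofReal (8 / μ) * ENNReal.ofReal (8 / μ)) := by
        rw [show (2 : ℝ≥0∞) = ENNReal.ofReal 2 by simp]
        gcongr <;> exact tsum_int_inv_sq_add_sq_le hμ
    _ = ENNReal.ofReal (128 / μ ^ 2) := by
        rw [← ENNReal.ofReal_mul (by positivity), ← ENNReal.ofReal_mul (by positivity)]
        congr 1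
        field_simp
        norm_num

/-! ### Fourier coefficients on the torus -/

/-- The normalized Haar measure, which is the one used for `UnitAddTorus` Fourier series. -/
local instance : MeasureSpace UnitAddCircle := ⟨AddCircle.haarAddCircle⟩

local instance : Measure.IsAddHaarMeasure (volume : Measure UnitAddCircle) :=
  inferInstanceAs (Measure.IsAddHaarMeasure AddCircle.haarAddCircle)

local instance : IsProbabilityMeasure (volume : Measure UnitAddCircle) :=
  inferInstanceAs (IsProbabilityMeasure AddCircle.haarAddCircle)

theorem UnitAddTorus.hasSum_mFourierCoeff_mul {d : Type*} [Fintype d]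
    (f g : C(UnitAddTorus d, ℂ)) (n : d → ℤ) :
    HasSum (fun j => mFourierCoeff f j * mFourierCoeff g (n - j)) (mFourierCoeff (f * g) n) := by
  set h : C(UnitAddTorus d, ℂ) := mFourier n * star g with hh
  have key := hasSum_prod_mFourierCoeff (ContinuousMap.toLp 2 volume ℂ h)
    (ContinuousMap.toLp 2 volume ℂ f)
  simp only [mFourierCoeff_toLp] at key
  convert! key using 1
  · funext j
    rw [mul_comm]
    congr 1
    unfold mFourierCoeff
    rw [← integral_conj]
    congr 1
    funext t
    simp only [hh, smul_eq_mul, map_mul, ContinuousMap.mul_apply, ContinuousMap.star_apply,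
      RCLike.star_def, RCLike.conj_conj, ← mFourier_neg, ← mul_assoc, ← mFourier_add]
    congr 3
    abel
  · unfold mFourierCoeff
    refine integral_congr_ae ?_
    filter_upwards [ContinuousMap.coeFn_toLp (p := 2) (𝕜 := ℂ) volume h,
      ContinuousMap.coeFn_toLp (p := 2) (𝕜 := ℂ) volume f] with t h1 h2
    rw [h1, h2]
    simp only [hh, smul_eq_mul, map_mul, ContinuousMap.mul_apply, ContinuousMap.star_apply,
      RCLike.star_def, RCLike.conj_conj, ← mFourier_neg]
    ring

theorem UnitAddTorus.hasSum_sq_mFourierCoeff_continuousMap {d : Type*} [Fintype d]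
    (f : C(UnitAddTorus d, ℂ)) :
    HasSum (fun j => ‖mFourierCoeff f j‖ ^ 2) (∫ t, ‖f t‖ ^ 2) := by
  have key := hasSum_sq_mFourierCoeff (ContinuousMap.toLp 2 volume ℂ f)
  simp only [mFourierCoeff_toLp] at key
  convert! key using 1
  refine integral_congr_ae ?_
  filter_upwards [ContinuousMap.coeFn_toLp (p := 2) (𝕜 := ℂ) volume f] with t h1
  rw [h1]

/-- `2π`-periodicity in both variables. -/
def Biperiodic {E : Type*} (F : ℝ × ℝ → E) : Prop :=
  (∀ x y, F (x + 2 * π, y) = F (x, y)) ∧ ∀ x y, F (x, y + 2 * π) = F (x, y)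

open scoped Pointwise in
theorem setIntegral_unit_square {E : Type*} [NormedAddCommGroup E] [NormedSpace ℝ E]
    (F : ℝ × ℝ → E) :
    ∫ x : Fin 2 → ℝ in {x | ∀ i, x i ∈ Set.Ioc ((0 : Fin 2 → ℝ) i) ((0 : Fin 2 → ℝ) i + 1)},
      F (2 * π * x 0, 2 * π * x 1) = ((2 * π) ^ 2)⁻¹ • ∫ p in sq2, F p := by
  have hpi : (0 : ℝ) < 2 * π := by positivity
  have h1 := (volume_preserving_finTwoArrow ℝ).setIntegral_preimage_emb
    (MeasurableEquiv.measurableEmbedding _) (fun p => F ((2 * π) • p))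
    (Set.Ioc (0 : ℝ) 1 ×ˢ Set.Ioc (0 : ℝ) 1)
  have h2 := Measure.setIntegral_comp_smul (volume : Measure (ℝ × ℝ)) F
    (Set.Ioc (0 : ℝ) 1 ×ˢ Set.Ioc (0 : ℝ) 1) hpi.ne'
  have hset : (2 * π) • (Set.Ioc (0 : ℝ) 1 ×ˢ Set.Ioc (0 : ℝ) 1) =
      Set.Ioc (0 : ℝ) (2 * π) ×ˢ Set.Ioc (0 : ℝ) (2 * π) := by
    ext p
    rw [Set.mem_smul_set_iff_inv_smul_mem₀ hpi.ne']
    simp only [Set.mem_prod, Set.mem_Ioc, Prod.smul_fst, Prod.smul_snd, smul_eq_mul,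
      inv_mul_le_iff₀ hpi, inv_pos, mul_pos_iff_of_pos_left, hpi, mul_one]
  have hres : (∫ p in Set.Ioc (0 : ℝ) (2 * π) ×ˢ Set.Ioc (0 : ℝ) (2 * π), F p) =
      ∫ p in sq2, F p :=
    setIntegral_congr_set (Measure.set_prod_ae_eq Ioc_ae_eq_Icc Ioc_ae_eq_Icc)
  rw [h2, hset, hres] at h1
  have hfr : Module.finrank ℝ (ℝ × ℝ) = 2 := by simp
  rw [hfr, abs_of_nonneg (by positivity)] at h1
  rw [← h1]
  congr 2
  ext x
  simp [Fin.forall_fin_two]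

/-- The function on the torus induced by a biperiodic continuous function on the plane. -/
theorem exists_torus_lift {F : ℝ × ℝ → ℂ} (hF : Continuous F) (hper : Biperiodic F) :
    ∃ V : C(UnitAddTorus (Fin 2), ℂ), ∀ x : Fin 2 → ℝ,
      V (fun i => (x i : UnitAddCircle)) = F (2 * π * x 0, 2 * π * x 1) := by
  have hquot : IsOpenQuotientMap
      (Pi.map fun _ : Fin 2 => (QuotientAddGroup.mk : ℝ → UnitAddCircle)) :=
    IsOpenQuotientMap.piMap fun _ => QuotientAddGroup.isOpenQuotientMap_mk
  have h1 (y : ℝ) : Function.Periodic (fun x => F (x, y)) (2 * π) := fun x => hper.1 x y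
  have h2 (x : ℝ) : Function.Periodic (fun y => F (x, y)) (2 * π) := hper.2 x
  let V : UnitAddTorus (Fin 2) → ℂ := fun t => F (2 * π * (t 0).out, 2 * π * (t 1).out)
  have hout (s : ℝ) : ∃ n : ℤ, 2 * π * ((s : UnitAddCircle).out : ℝ) = 2 * π * s + n * (2 * π) := by
    have : (((s : UnitAddCircle).out : ℝ) : UnitAddCircle) = (s : UnitAddCircle) :=
      Quotient.out_eq' _
    obtain ⟨n, hn⟩ := (QuotientAddGroup.eq_iff_sub_mem.1 this)
    refine ⟨n, ?_⟩
    simp only [zsmul_eq_mul, mul_one] at hn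
    rw [hn]
    ring
  have hV (x : Fin 2 → ℝ) : V (fun i => (x i : UnitAddCircle)) = F (2 * π * x 0, 2 * π * x 1) := by
    obtain ⟨m, hm⟩ := hout (x 0)
    obtain ⟨n, hn⟩ := hout (x 1)
    simp only [V, hm, hn]
    exact ((h1 _).int_mul m _).trans ((h2 _).int_mul n _)
  refine ⟨⟨V, ?_⟩, hV⟩
  rw [← hquot.continuous_comp_iff]
  have : V ∘ (Pi.map fun _ : Fin 2 => (QuotientAddGroup.mk : ℝ → UnitAddCircle)) =
      fun x => F (2 * π * x 0, 2 * π * x 1) := funext hV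
  rw [this]
  fun_prop

/-- The character `p ↦ exp (-i k ⋅ p)`. -/
def char2 (k : Fin 2 → ℤ) (p : ℝ × ℝ) : ℂ :=
  Complex.exp (-(Complex.I * (k 0 * p.1 + k 1 * p.2)))

/-- Fourier coefficients of a function on the plane, over the fundamental domain `[0, 2π]²`. -/
def fc (F : ℝ × ℝ → ℂ) (k : Fin 2 → ℤ) : ℂ := ((2 * π) ^ 2)⁻¹ • ∫ p in sq2, char2 k p * F p

theorem mFourierCoeff_torus_lift {F : ℝ × ℝ → ℂ} {V : C(UnitAddTorus (Fin 2), ℂ)}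
    (hV : ∀ x : Fin 2 → ℝ, V (fun i => (x i : UnitAddCircle)) = F (2 * π * x 0, 2 * π * x 1))
    (k : Fin 2 → ℤ) : UnitAddTorus.mFourierCoeff V k = fc F k := by
  rw [UnitAddTorus.mFourierCoeff_eq_integral V k 0, fc, ← setIntegral_unit_square]
  congr 1
  funext x
  rw [hV, smul_eq_mul]
  congr 1
  simp only [UnitAddTorus.mFourier, char2, ContinuousMap.coe_mk, Fin.prod_univ_two, fourier_coe_apply,
    ← Complex.exp_add]
  congr 1
  push_cast
  simp
  ring

theorem hasSum_sq_fc {F : ℝ × ℝ → ℂ} (hF : Continuous F) (hper : Biperiodic F) :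
    HasSum (fun k => ‖fc F k‖ ^ 2) (((2 * π) ^ 2)⁻¹ * ∫ p in sq2, ‖F p‖ ^ 2) := by
  obtain ⟨V, hV⟩ := exists_torus_lift hF hper
  have h := UnitAddTorus.hasSum_sq_mFourierCoeff_continuousMap V
  simp_rw [mFourierCoeff_torus_lift hV] at h
  rw [UnitAddTorus.integral_preimage _ 0] at h
  simp_rw [hV] at h
  rwa [setIntegral_unit_square fun p => ‖F p‖ ^ 2, smul_eq_mul] at h

theorem enorm_fc_mul_le {F H : ℝ × ℝ → ℂ} (hF : Continuous F) (hFper : Biperiodic F)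
    (hH : Continuous H) (hHper : Biperiodic H) (n : Fin 2 → ℤ) :
    ‖fc (fun p => F p * H p) n‖ₑ ≤ conv (fun k => ‖fc F k‖ₑ) (fun k => ‖fc H k‖ₑ) n := by
  obtain ⟨V, hV⟩ := exists_torus_lift hF hFper
  obtain ⟨W, hW⟩ := exists_torus_lift hH hHper
  have h := UnitAddTorus.hasSum_mFourierCoeff_mul V W n
  have hVW (x : Fin 2 → ℝ) : (V * W : C(UnitAddTorus (Fin 2), ℂ)) (fun i => (x i : UnitAddCircle)) =
      (fun p => F p * H p) (2 * π * x 0, 2 * π * x 1) := by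
    simp [hV, hW]
  simp_rw [mFourierCoeff_torus_lift hV, mFourierCoeff_torus_lift hW] at h
  have hdiv := mFourierCoeff_torus_lift (F := fun p => F p * H p) hVW n
  rw [← hdiv]
  refine (le_of_eq (congrArg _ h.tsum_eq.symm)).trans (enorm_tsum_le_tsum_enorm.trans ?_)
  simp only [enorm_mul]
  rfl

/-! ### Fourier coefficients and derivatives -/

theorem isCompact_sq2 : IsCompact sq2 := isCompact_Icc.prod isCompact_Icc

theorem integrableOn_sq2 {E : Type*} [NormedAddCommGroup E] {F : ℝ × ℝ → E} (hF : Continuous F) :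
    IntegrableOn F sq2 :=
  hF.continuousOn.integrableOn_compact isCompact_sq2

theorem integral_fderiv_eq_zero {h : ℝ × ℝ → ℂ} (hh : ContDiff ℝ 1 h) (hper : Biperiodic h)
    (d : ℝ × ℝ) : ∫ p in sq2, fderiv ℝ h p d = 0 := by
  have hdiff : Differentiable ℝ h := hh.differentiable (by norm_num)
  have hcont : Continuous fun p => fderiv ℝ h p d :=
    (hh.continuous_fderiv (by norm_num)).clm_apply continuous_const
  have hd (p : ℝ × ℝ) :
      (d.1 • fderiv ℝ h p) (1, 0) + (d.2 • fderiv ℝ h p) (0, 1) = fderiv ℝ h p d := by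
    simp only [smul_apply, ← map_smul, ← map_add]
    congr 1
    ext <;> simp
  have hsq : sq2 = Set.Icc ((0 : ℝ), (0 : ℝ)) (2 * π, 2 * π) := by
    rw [← Set.Icc_prod_Icc]; rfl
  have hle : ((0 : ℝ), (0 : ℝ)) ≤ (2 * π, 2 * π) := by
    constructor <;> simp only <;> positivity
  have key := integral_divergence_prod_Icc_of_hasFDerivAt_of_le (fun p => d.1 • h p)
    (fun p => d.2 • h p) (fun p => d.1 • fderiv ℝ h p) (fun p => d.2 • fderiv ℝ h p)
    (0, 0) (2 * π, 2 * π) hle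
    (hdiff.continuous.const_smul d.1).continuousOn (hdiff.continuous.const_smul d.2).continuousOn
    (fun p _ => (hdiff p).hasFDerivAt.const_smul d.1)
    (fun p _ => (hdiff p).hasFDerivAt.const_smul d.2)
    (by simp_rw [hd]; rw [← hsq]; exact integrableOn_sq2 hcont)
  simp_rw [hd] at key
  rw [hsq, key]
  have h1 (y : ℝ) : h (2 * π, y) = h (0, y) := by simpa using hper.1 0 y
  have h2 (x : ℝ) : h (x, 2 * π) = h (x, 0) := by simpa using hper.2 x 0
  simp [h1, h2]

/-- The phase of `char2 k` as a continuous linear map. -/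
def phase (k : Fin 2 → ℤ) : ℝ × ℝ →L[ℝ] ℂ :=
  -(Complex.I • ((k 0 : ℂ) • Complex.ofRealCLM.comp (ContinuousLinearMap.fst ℝ ℝ ℝ) +
    (k 1 : ℂ) • Complex.ofRealCLM.comp (ContinuousLinearMap.snd ℝ ℝ ℝ)))

theorem phase_apply (k : Fin 2 → ℤ) (p : ℝ × ℝ) :
    phase k p = -(Complex.I * (k 0 * p.1 + k 1 * p.2)) := by
  simp [phase]
  ring

theorem char2_eq (k : Fin 2 → ℤ) : char2 k = fun p => Complex.exp (phase k p) := by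
  funext p
  rw [phase_apply, char2]

theorem contDiff_char2 (k : Fin 2 → ℤ) {n : WithTop ℕ∞} : ContDiff ℝ n (char2 k) := by
  rw [char2_eq]
  exact (phase k).contDiff.cexp

theorem biperiodic_char2 (k : Fin 2 → ℤ) : Biperiodic (char2 k) := by
  constructor <;> intro x y <;> unfold char2 <;> rw [Complex.exp_eq_exp_iff_exists_int]
  · exact ⟨-k 0, by push_cast; ring⟩
  · exact ⟨-k 1, by push_cast; ring⟩

theorem hasFDerivAt_char2 (k : Fin 2 → ℤ) (p : ℝ × ℝ) :
    HasFDerivAt (char2 k) (char2 k p • phase k) p := by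
  rw [char2_eq]
  exact (phase k).hasFDerivAt.cexp

theorem SmoothPeriodic.biperiodic_ofReal {v : ℝ × ℝ → ℝ} (hv : SmoothPeriodic v) :
    Biperiodic fun p => (v p : ℂ) :=
  ⟨fun x y => congrArg _ (hv.2.1 x y), fun x y => congrArg _ (hv.2.2 x y)⟩

theorem SmoothPeriodic.continuous {v : ℝ × ℝ → ℝ} (hv : SmoothPeriodic v) : Continuous v :=
  hv.1.continuous

theorem SmoothPeriodic.continuous_ofReal {v : ℝ × ℝ → ℝ} (hv : SmoothPeriodic v) :
    Continuous fun p => (v p : ℂ) :=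
  Complex.continuous_ofReal.comp hv.continuous

theorem SmoothPeriodic.differentiable {v : ℝ × ℝ → ℝ} (hv : SmoothPeriodic v) :
    Differentiable ℝ v :=
  hv.1.differentiable (by simp)

theorem SmoothPeriodic.fderiv_apply {v : ℝ × ℝ → ℝ} (hv : SmoothPeriodic v) (d : ℝ × ℝ) :
    SmoothPeriodic fun p => fderiv ℝ v p d := by
  refine ⟨?_, fun x y => ?_, fun x y => ?_⟩
  · exact (hv.1.fderiv_right (m := ((⊤ : ℕ∞) : WithTop ℕ∞)) (by simp)).clm_apply contDiff_const
  · have h : (fun p : ℝ × ℝ => v (p + (2 * π, 0))) = v := by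
      funext p
      rw [show p + (2 * π, 0) = (p.1 + 2 * π, p.2) by ext <;> simp]
      exact hv.2.1 p.1 p.2
    have := fderiv_comp_add_right (𝕜 := ℝ) (f := v) (x := (x, y)) (2 * π, 0)
    rw [h] at this
    simp [this]
  · have h : (fun p : ℝ × ℝ => v (p + (0, 2 * π))) = v := by
      funext p
      rw [show p + (0, 2 * π) = (p.1, p.2 + 2 * π) by ext <;> simp]
      exact hv.2.2 p.1 p.2
    have := fderiv_comp_add_right (𝕜 := ℝ) (f := v) (x := (x, y)) (0, 2 * π)
    rw [h] at this
    simp [this]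

theorem SmoothPeriodic.mul {v w : ℝ × ℝ → ℝ} (hv : SmoothPeriodic v) (hw : SmoothPeriodic w) :
    SmoothPeriodic fun p => v p * w p :=
  ⟨hv.1.mul hw.1, fun x y => congrArg₂ _ (hv.2.1 x y) (hw.2.1 x y),
    fun x y => congrArg₂ _ (hv.2.2 x y) (hw.2.2 x y)⟩

theorem SmoothPeriodic.aop {v : ℝ × ℝ → ℝ} (hv : SmoothPeriodic v) : SmoothPeriodic (Aop v) := by
  have hx := (hv.fderiv_apply (1, 0)).fderiv_apply (1, 0)
  have hy := (hv.fderiv_apply (0, 1)).fderiv_apply (0, 1)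
  refine ⟨(hx.1.add hy.1).neg.add hv.1, fun x y => ?_, fun x y => ?_⟩
  · exact congrArg₂ (· + ·) (congrArg Neg.neg (congrArg₂ (· + ·) (hx.2.1 x y) (hy.2.1 x y)))
      (hv.2.1 x y)
  · exact congrArg₂ (· + ·) (congrArg Neg.neg (congrArg₂ (· + ·) (hx.2.2 x y) (hy.2.2 x y)))
      (hv.2.2 x y)

theorem SmoothPeriodic.aop_iterate {v : ℝ × ℝ → ℝ} (hv : SmoothPeriodic v) (j : ℕ) :
    SmoothPeriodic (Aop^[j] v) := by
  induction j with
  | zero => exact hv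
  | succ j ih => rw [Function.iterate_succ_apply']; exact ih.aop

theorem integrableOn_char2_mul {v : ℝ × ℝ → ℝ} (hv : Continuous v) (k : Fin 2 → ℤ) :
    IntegrableOn (fun p => char2 k p * (v p : ℂ)) sq2 :=
  integrableOn_sq2 ((contDiff_char2 k (n := 0)).continuous.mul (Complex.continuous_ofReal.comp hv))

theorem fc_fderiv_apply {v : ℝ × ℝ → ℝ} (hv : SmoothPeriodic v) (d : ℝ × ℝ) (k : Fin 2 → ℤ) :
    fc (fun p => (fderiv ℝ v p d : ℂ)) k = -phase k d * fc (fun p => (v p : ℂ)) k := by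
  have hper : Biperiodic fun p => char2 k p * (v p : ℂ) :=
    ⟨fun x y => congrArg₂ _ ((biperiodic_char2 k).1 x y) (hv.biperiodic_ofReal.1 x y),
      fun x y => congrArg₂ _ ((biperiodic_char2 k).2 x y) (hv.biperiodic_ofReal.2 x y)⟩
  have hsm : ContDiff ℝ 1 fun p => char2 k p * (v p : ℂ) :=
    (contDiff_char2 k).mul (Complex.ofRealCLM.contDiff.comp (hv.1.of_le (by exact_mod_cast le_top)))
  have hder (p : ℝ × ℝ) : fderiv ℝ (fun p => char2 k p * (v p : ℂ)) p d =
      char2 k p * (fderiv ℝ v p d : ℂ) + phase k d * (char2 k p * (v p : ℂ)) := by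
    have h1 := (hasFDerivAt_char2 k p).mul
      ((Complex.ofRealCLM.hasFDerivAt (x := v p)).comp p (hv.differentiable p).hasFDerivAt)
    have h2 : fderiv ℝ (fun p => char2 k p * (v p : ℂ)) p = _ := h1.fderiv
    rw [h2]
    simp
    ring
  have h0 := integral_fderiv_eq_zero hsm hper d
  simp_rw [hder] at h0
  rw [integral_add (integrableOn_char2_mul (hv.fderiv_apply d).continuous k)
    ((integrableOn_char2_mul hv.continuous k).const_mul _), integral_const_mul] at h0
  unfold fc
  rw [eq_neg_of_add_eq_zero_left h0, mul_smul_comm, neg_mul]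

theorem fc_aop {v : ℝ × ℝ → ℝ} (hv : SmoothPeriodic v) (k : Fin 2 → ℤ) :
    fc (fun p => (Aop v p : ℂ)) k = symb k * fc (fun p => (v p : ℂ)) k := by
  have hx := hv.fderiv_apply (1, 0)
  have hy := hv.fderiv_apply (0, 1)
  have hxx := fc_fderiv_apply hx (1, 0) k
  have hyy := fc_fderiv_apply hy (0, 1) k
  rw [fc_fderiv_apply hv] at hxx hyy
  have hsplit : fc (fun p => (Aop v p : ℂ)) k =
      -(fc (fun p => (fderiv ℝ (fun q => fderiv ℝ v q (1, 0)) p (1, 0) : ℂ)) k +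
        fc (fun p => (fderiv ℝ (fun q => fderiv ℝ v q (0, 1)) p (0, 1) : ℂ)) k) +
        fc (fun p => (v p : ℂ)) k := by
    have ix := integrableOn_char2_mul (hx.fderiv_apply (1, 0)).continuous k
    have iy := integrableOn_char2_mul (hy.fderiv_apply (0, 1)).continuous k
    have iv := integrableOn_char2_mul hv.continuous k
    have hint := integral_add (ix.add iy).neg iv
    simp only [Pi.neg_apply, Pi.add_apply] at hint
    rw [integral_neg, integral_add ix iy] at hint
    unfold fc
    rw [← smul_add, ← smul_neg, ← smul_add, ← hint]
    congr 2
    funext p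
    have hA : Aop v p = -(fderiv ℝ (fun q => fderiv ℝ v q (1, 0)) p (1, 0) +
      fderiv ℝ (fun q => fderiv ℝ v q (0, 1)) p (0, 1)) + v p := rfl
    simp only [hA]
    push_cast
    ring
  rw [hsplit, hxx, hyy]
  simp only [phase_apply, symb]
  push_cast
  linear_combination (-(k 0 : ℂ) ^ 2 - (k 1 : ℂ) ^ 2) * fc (fun p => (v p : ℂ)) k * Complex.I_sq

/-- Absolute values of the Fourier coefficients of a real function. -/
def coef (v : ℝ × ℝ → ℝ) (k : Fin 2 → ℤ) : ℝ≥0∞ := ‖fc (fun p => (v p : ℂ)) k‖ₑ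

theorem coef_aop_iterate {v : ℝ × ℝ → ℝ} (hv : SmoothPeriodic v) (j : ℕ) (k : Fin 2 → ℤ) :
    coef (Aop^[j] v) k = ENNReal.ofReal (symb k) ^ j * coef v k := by
  induction j with
  | zero => simp
  | succ j ih =>
    have h : coef (Aop (Aop^[j] v)) k = ENNReal.ofReal (symb k) * coef (Aop^[j] v) k := by
      unfold coef
      rw [fc_aop (hv.aop_iterate j), enorm_mul, ← ofReal_norm (symb k : ℂ),
        Complex.norm_real, Real.norm_of_nonneg (zero_le_one.trans (one_le_symb k))]
    rw [Function.iterate_succ_apply', h, ih, pow_succ]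
    ring

theorem coef_mul_le {v w : ℝ × ℝ → ℝ} (hv : SmoothPeriodic v) (hw : SmoothPeriodic w)
    (n : Fin 2 → ℤ) : coef (fun p => v p * w p) n ≤ conv (coef v) (coef w) n := by
  unfold coef
  push_cast
  exact enorm_fc_mul_le hv.continuous_ofReal hv.biperiodic_ofReal
    hw.continuous_ofReal hw.biperiodic_ofReal n

/-- Parseval's identity. -/
theorem tsum_coef_sq {v : ℝ × ℝ → ℝ} (hv : SmoothPeriodic v) :
    ∑' k, coef v k ^ 2 = ENNReal.ofReal ((l2norm v / (2 * π)) ^ 2) := by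
  have h := hasSum_sq_fc hv.continuous_ofReal hv.biperiodic_ofReal
  have hsum : (l2norm v / (2 * π)) ^ 2 =
      ((2 * π) ^ 2)⁻¹ * ∫ p in sq2, ‖((v p : ℝ) : ℂ)‖ ^ 2 := by
    rw [l2norm, div_pow, Real.sq_sqrt (integral_nonneg fun p => sq_nonneg _), div_eq_inv_mul]
    simp
  rw [hsum, ← h.tsum_eq, ENNReal.ofReal_tsum_of_nonneg (fun k => sq_nonneg _) h.summable]
  refine tsum_congr fun k => ?_
  rw [ENNReal.ofReal_pow (norm_nonneg _), ofReal_norm]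
  rfl

/-! ### Estimates for the norms `‖A^j u‖` -/

theorem SmoothPeriodic.tsum_symb_pow_mul_coef_sq {u : ℝ × ℝ → ℝ} (hu : SmoothPeriodic u) (j : ℕ) :
    ∑' k, (ENNReal.ofReal (symb k) ^ j * coef u k) ^ 2 =
      ENNReal.ofReal ((l2norm (Aop^[j] u) / (2 * π)) ^ 2) := by
  rw [← tsum_coef_sq (hu.aop_iterate j)]
  simp_rw [coef_aop_iterate hu]

theorem l2norm_nonneg (u : ℝ × ℝ → ℝ) : 0 ≤ l2norm u := Real.sqrt_nonneg _

theorem SmoothPeriodic.l2norm_aop_iterate_sq_le {u : ℝ × ℝ → ℝ} (hu : SmoothPeriodic u) (j : ℕ) :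
    l2norm (Aop^[j + 1] u) ^ 2 ≤ l2norm (Aop^[j] u) * l2norm (Aop^[j + 2] u) := by
  have h := sq_tsum_le_tsum_mul_tsum
    (a := fun k => (ENNReal.ofReal (symb k) ^ j * coef u k) ^ 2)
    (b := fun k => (ENNReal.ofReal (symb k) ^ (j + 2) * coef u k) ^ 2)
    (c := fun k => (ENNReal.ofReal (symb k) ^ (j + 1) * coef u k) ^ 2)
    (fun k => le_of_eq (by ring))
  rw [hu.tsum_symb_pow_mul_coef_sq, hu.tsum_symb_pow_mul_coef_sq, hu.tsum_symb_pow_mul_coef_sq,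
    ← ENNReal.ofReal_pow (sq_nonneg _), ← ENNReal.ofReal_mul (sq_nonneg _),
    ENNReal.ofReal_le_ofReal_iff (by positivity)] at h
  have h0 := l2norm_nonneg (Aop^[j] u)
  have h2 := l2norm_nonneg (Aop^[j + 2] u)
  refine le_of_pow_le_pow_left₀ (n := 2) two_ne_zero (by positivity) ?_
  have hK : (0 : ℝ) < (2 * π) ^ 4 := by positivity
  rw [← div_le_div_iff_of_pos_right hK]
  refine (le_of_eq ?_).trans (h.trans (le_of_eq ?_)) <;> field_simp

theorem SmoothPeriodic.l2norm_aop_iterate_le_succ {u : ℝ × ℝ → ℝ} (hu : SmoothPeriodic u)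
    (j : ℕ) : l2norm (Aop^[j] u) ≤ l2norm (Aop^[j + 1] u) := by
  have h : ∑' k, (ENNReal.ofReal (symb k) ^ j * coef u k) ^ 2 ≤
      ∑' k, (ENNReal.ofReal (symb k) ^ (j + 1) * coef u k) ^ 2 := by
    refine ENNReal.tsum_le_tsum fun k => ?_
    gcongr
    · exact ENNReal.one_le_ofReal.2 (one_le_symb k)
    · omega
  rw [hu.tsum_symb_pow_mul_coef_sq, hu.tsum_symb_pow_mul_coef_sq,
    ENNReal.ofReal_le_ofReal_iff (sq_nonneg _)] at h
  have h0 := l2norm_nonneg (Aop^[j + 1] u)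
  have hdiv := le_of_pow_le_pow_left₀ two_ne_zero (by positivity) h
  rwa [div_le_div_iff_of_pos_right (by positivity)] at hdiv

/-- Agmon's inequality in the Wiener algebra. -/
theorem SmoothPeriodic.sq_tsum_coef_le {u : ℝ × ℝ → ℝ} (hu : SmoothPeriodic u) :
    (∑' k, coef u k) ^ 2 ≤
      ENNReal.ofReal (256 / (2 * π) ^ 2 * (l2norm u * l2norm (Aop u))) := by
  have hS0 := hu.tsum_symb_pow_mul_coef_sq 0
  have hS1 := hu.tsum_symb_pow_mul_coef_sq 1
  have hmono := hu.l2norm_aop_iterate_le_succ 0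
  simp only [zero_add, pow_zero, pow_one, one_mul, Function.iterate_zero, id_eq,
    Function.iterate_one] at hS0 hS1 hmono
  rcases (l2norm_nonneg u).eq_or_lt with h0 | h0
  · rw [← h0] at hS0
    simp only [zero_div, ne_eq, OfNat.ofNat_ne_zero, not_false_eq_true, zero_pow,
      ENNReal.ofReal_zero, ENNReal.tsum_eq_zero, pow_eq_zero_iff] at hS0
    simp [hS0]
  set Y0 := l2norm u
  set Y1 := l2norm (Aop u)
  have hY1 : 0 < Y1 := h0.trans_le hmono
  set t : ℝ := Y1 / Y0 with ht
  have ht1 : 1 ≤ t := (one_le_div h0).2 hmono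
  have hμ : 1 ≤ √t := Real.one_le_sqrt.2 ht1
  have hμ2 : √t ^ 2 = t := Real.sq_sqrt (by positivity)
  have hlat := tsum_inv_sq_add_symb_sq_le hμ
  rw [hμ2] at hlat
  have hCS := sq_tsum_le_tsum_mul_tsum
    (a := fun k => ENNReal.ofReal (t ^ 2 + symb k ^ 2) * coef u k ^ 2)
    (b := fun k => ENNReal.ofReal (1 / (t ^ 2 + symb k ^ 2))) (c := coef u) (fun k => by
      rw [mul_right_comm, ← ENNReal.ofReal_mul (by positivity), mul_one_div_cancel (by positivity)]
      simp)
  have hsum : ∑' k, ENNReal.ofReal (t ^ 2 + symb k ^ 2) * coef u k ^ 2 =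
      ENNReal.ofReal (2 * (Y1 / (2 * π)) ^ 2) := by
    calc _ = ∑' k, (ENNReal.ofReal (t ^ 2) * coef u k ^ 2 +
          (ENNReal.ofReal (symb k) * coef u k) ^ 2) := by
          refine tsum_congr fun k => ?_
          rw [ENNReal.ofReal_add (by positivity) (by positivity), add_mul, mul_pow,
            ENNReal.ofReal_pow (zero_le_one.trans (one_le_symb k))]
      _ = _ := by
          rw [ENNReal.tsum_add, ENNReal.tsum_mul_left, hS0, hS1,
            ← ENNReal.ofReal_mul (by positivity), ← ENNReal.ofReal_add (by positivity)
              (by positivity)]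
          congr 1
          rw [ht]
          field_simp
          norm_num
  calc _ ≤ _ := hCS
    _ ≤ ENNReal.ofReal (2 * (Y1 / (2 * π)) ^ 2) * ENNReal.ofReal (128 / t) := by
        rw [hsum]
        gcongr
    _ = _ := by
        rw [← ENNReal.ofReal_mul (by positivity)]
        congr 1
        rw [ht]
        field_simp
        norm_num

theorem exists_l2norm_aop_iterate_cube_le (p : ℕ) :
    ∃ C : ℝ, 0 ≤ C ∧ ∀ u : ℝ × ℝ → ℝ, SmoothPeriodic u →
      l2norm (Aop^[p] fun q => u q ^ 3) ≤
        C * (l2norm u * l2norm (Aop u) * l2norm (Aop^[p] u)) := by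
  obtain ⟨D, hD0, hDE⟩ : ∃ D : ℝ, 0 ≤ D ∧ (2 * (4 ^ p) ^ 2 : ℝ≥0∞) = ENNReal.ofReal D := by
    refine ⟨2 * (4 ^ p) ^ 2, by positivity, ?_⟩
    rw [ENNReal.ofReal_mul (by positivity), ENNReal.ofReal_pow (by positivity),
      ENNReal.ofReal_pow (by positivity)]
    simp
  have hw (j k : Fin 2 → ℤ) : ENNReal.ofReal (symb (j + k)) ≤
      2 * (ENNReal.ofReal (symb j) + ENNReal.ofReal (symb k)) := by
    have hj := one_le_symb j
    have hk := one_le_symb k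
    rw [show (2 : ℝ≥0∞) = ENNReal.ofReal 2 by simp, ← ENNReal.ofReal_add (by linarith)
      (by linarith), ← ENNReal.ofReal_mul (by norm_num)]
    exact ENNReal.ofReal_le_ofReal (symb_add_le j k)
  refine ⟨√(D + 2 * D ^ 2) * (256 / (2 * π) ^ 2), by positivity, fun u hu => ?_⟩
  have hu2 := hu.mul hu
  have hu3 := hu.mul hu2
  have hcube : (fun q => u q ^ 3) = fun q => u q * (u q * u q) := by
    funext q
    ring
  have hS := hu.tsum_symb_pow_mul_coef_sq p
  have hS3 := hu3.tsum_symb_pow_mul_coef_sq p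
  have e2 := tsum_weight_conv_sq_le hw p (coef_mul_le hu hu)
  have e3 := tsum_weight_conv_sq_le hw p (coef_mul_le hu hu2)
  have b2 : ∑' k, coef (fun q => u q * u q) k ≤ (∑' k, coef u k) ^ 2 := by
    rw [sq, ← tsum_conv]
    exact ENNReal.tsum_le_tsum (coef_mul_le hu hu)
  have hB := hu.sq_tsum_coef_le
  rw [← hcube] at hS3 e3
  rw [hDE] at e2 e3
  rw [hS] at e2 e3
  rw [hS3] at e3
  have h0 := l2norm_nonneg u
  have h1 := l2norm_nonneg (Aop u)
  have hp := l2norm_nonneg (Aop^[p] u)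
  set B := ∑' k, coef u k
  obtain ⟨S, hS⟩ : ∃ S, S = (l2norm (Aop^[p] u) / (2 * π)) ^ 2 := ⟨_, rfl⟩
  obtain ⟨T, hT⟩ : ∃ T, T = 256 / (2 * π) ^ 2 * (l2norm u * l2norm (Aop u)) := ⟨_, rfl⟩
  rw [← hS] at e2 e3
  rw [← hT] at hB
  have hT0 : 0 ≤ T := by rw [hT]; positivity
  have hS0 : 0 ≤ S := hS ▸ sq_nonneg _
  have key : ENNReal.ofReal ((l2norm (Aop^[p] fun q => u q ^ 3) / (2 * π)) ^ 2) ≤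
      ENNReal.ofReal ((D + 2 * D ^ 2) * T ^ 2 * S) := by
    calc _ ≤ _ := e3
      _ ≤ ENNReal.ofReal D * (ENNReal.ofReal S * (B ^ 2) ^ 2 +
          B ^ 2 * (ENNReal.ofReal D * (ENNReal.ofReal S * B ^ 2 + B ^ 2 * ENNReal.ofReal S))) := by
          gcongr
      _ ≤ ENNReal.ofReal D * (ENNReal.ofReal S * ENNReal.ofReal T ^ 2 +
          ENNReal.ofReal T * (ENNReal.ofReal D * (ENNReal.ofReal S * ENNReal.ofReal T +
            ENNReal.ofReal T * ENNReal.ofReal S))) := by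
          gcongr
      _ = _ := by
          rw [ENNReal.ofReal_mul (by positivity), ENNReal.ofReal_mul (by positivity),
            ENNReal.ofReal_add (by positivity) (by positivity), ENNReal.ofReal_mul (by positivity),
            ENNReal.ofReal_pow hT0, ENNReal.ofReal_pow hD0, ENNReal.ofReal_ofNat]
          ring
  rw [ENNReal.ofReal_le_ofReal_iff (by positivity)] at key
  have hfac : (D + 2 * D ^ 2) * T ^ 2 * S =
      (√(D + 2 * D ^ 2) * T * (l2norm (Aop^[p] u) / (2 * π))) ^ 2 := by
    rw [hS, mul_pow, mul_pow, Real.sq_sqrt (by positivity)]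
  rw [hfac] at key
  have hdiv := le_of_pow_le_pow_left₀ two_ne_zero (by positivity) key
  rw [← mul_div_assoc, div_le_div_iff_of_pos_right (by positivity)] at hdiv
  refine hdiv.trans (le_of_eq ?_)
  rw [hT]
  ring

/-! ### Log-convex sequences -/

theorem mul_le_mul_of_logConvex {y : ℕ → ℝ} (hpos : ∀ j, 0 ≤ y j)
    (hconv : ∀ j, y (j + 1) ^ 2 ≤ y j * y (j + 2)) (hmono : ∀ j, y j ≤ y (j + 1)) (j : ℕ) :
    y 1 * y j ≤ y 0 * y (j + 1) := by
  rcases (hpos 0).eq_or_lt with h0 | h0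
  · have h1 : y 1 = 0 := by
      have := hconv 0
      rw [← h0, zero_mul, zero_add] at this
      exact pow_eq_zero_iff (two_ne_zero) |>.1 (le_antisymm this (sq_nonneg _))
    rw [h1, ← h0, zero_mul, zero_mul]
  induction j with
  | zero => exact (mul_comm _ _).le
  | succ j ih =>
    have hj : 0 < y j := h0.trans_le (monotone_nat_of_le_succ hmono j.zero_le)
    have hj1 : 0 < y (j + 1) := hj.trans_le (hmono j)
    refine le_of_mul_le_mul_right ?_ (mul_pos hj hj1)
    calc y 1 * y (j + 1) * (y j * y (j + 1)) = y 1 * y j * y (j + 1) ^ 2 := by ring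
      _ ≤ y 0 * y (j + 1) * (y j * y (j + 2)) :=
          mul_le_mul ih (hconv j) (sq_nonneg _) (mul_nonneg h0.le hj1.le)
      _ = y 0 * y (j + 1 + 1) * (y j * y (j + 1)) := by ring

theorem pow_succ_le_of_logConvex {y : ℕ → ℝ} (hpos : ∀ j, 0 ≤ y j)
    (hconv : ∀ j, y (j + 1) ^ 2 ≤ y j * y (j + 2)) (j : ℕ) :
    y j ^ (j + 1) ≤ y 0 * y (j + 1) ^ j := by
  induction j with
  | zero => simp
  | succ j ih =>
    have h0 := hpos 0
    have h2 := hpos (j + 2)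
    rcases (hpos (j + 1)).eq_or_lt with h | h
    · rw [← h, zero_pow (by omega)]
      positivity
    refine le_of_mul_le_mul_right ?_ (pow_pos h j)
    calc y (j + 1) ^ (j + 1 + 1) * y (j + 1) ^ j = (y (j + 1) ^ 2) ^ (j + 1) := by ring
      _ ≤ (y j * y (j + 2)) ^ (j + 1) := by
          gcongr
          exact hconv j
      _ = y j ^ (j + 1) * y (j + 2) ^ (j + 1) := mul_pow _ _ _
      _ ≤ y 0 * y (j + 1) ^ j * y (j + 2) ^ (j + 1) := by gcongr
      _ = _ := by ring

/-- A form of Young's inequality. -/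
theorem young_interpolation {a b X C ε : ℝ} (ha : 0 ≤ a) (_ : 0 ≤ b) (hX : 0 ≤ X) (hC : 0 ≤ C)
    (hε : 0 < ε) {m : ℕ} (h : b ^ (m + 1) ≤ a * X ^ m) :
    C * a ^ 2 * b * X ≤ ε * X ^ 2 + C * (C / ε) ^ (2 * m + 1) * a ^ (2 * (2 * m + 3)) := by
  rcases le_or_gt (C * a ^ 2 * b) (ε * X) with h1 | h1
  · have : C * a ^ 2 * b * X ≤ ε * X * X := by gcongr
    have : 0 ≤ C * (C / ε) ^ (2 * m + 1) * a ^ (2 * (2 * m + 3)) := by positivity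
    nlinarith
  rcases hX.eq_or_lt with h0 | h0
  · rw [← h0]
    simp only [mul_zero, ne_eq, OfNat.ofNat_ne_zero, not_false_eq_true, zero_pow, zero_add]
    positivity
  set k := C / ε with hk
  have hk0 : 0 ≤ k := by positivity
  have hXk : X ≤ k * a ^ 2 * b := by
    rw [hk, div_mul_eq_mul_div, div_mul_eq_mul_div, le_div_iff₀ hε]
    linarith
  have hXT : X ≤ k ^ (m + 1) * a ^ (2 * m + 3) := by
    refine le_of_mul_le_mul_right ?_ (pow_pos h0 m)
    calc X * X ^ m = X ^ (m + 1) := by ring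
      _ ≤ (k * a ^ 2 * b) ^ (m + 1) := by gcongr
      _ = (k * a ^ 2) ^ (m + 1) * b ^ (m + 1) := mul_pow _ _ _
      _ ≤ (k * a ^ 2) ^ (m + 1) * (a * X ^ m) := by gcongr
      _ = _ := by ring
  have hbT : b ≤ k ^ m * a ^ (2 * m + 1) := by
    refine le_of_pow_le_pow_left₀ (n := m + 1) (by omega) (by positivity) ?_
    calc b ^ (m + 1) ≤ a * X ^ m := h
      _ ≤ a * (k ^ (m + 1) * a ^ (2 * m + 3)) ^ m := by gcongr
      _ = _ := by ring
  calc C * a ^ 2 * b * X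
      ≤ C * a ^ 2 * (k ^ m * a ^ (2 * m + 1)) * (k ^ (m + 1) * a ^ (2 * m + 3)) := by gcongr
    _ = C * k ^ (2 * m + 1) * a ^ (2 * (2 * m + 3)) := by ring
    _ ≤ _ := le_add_of_nonneg_left (by positivity)

/-- Estimate for `‖A^{m+1}u‖ ‖A^{m−1}(u³)‖`. -/
theorem stmt_6 (m : ℕ) (hm : 1 ≤ m) :
    ∀ ε > (0 : ℝ), ∃ c > 0, ∀ u : ℝ × ℝ → ℝ, SmoothPeriodic u →
      l2norm (Aop^[m + 1] u) * l2norm (Aop^[m - 1] (fun p => (u p) ^ 3)) ≤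
        ε * l2norm (Aop^[m + 1] u) ^ 2 + c * (l2norm u ^ (2 * (2 * m + 3)) + 1) := by
  intro ε hε
  obtain ⟨C, hC, hcube⟩ := exists_l2norm_aop_iterate_cube_le (m - 1)
  refine ⟨C * (C / ε) ^ (2 * m + 1) + 1, by positivity, fun u hu => ?_⟩
  set y : ℕ → ℝ := fun j => l2norm (Aop^[j] u) with hy
  have hpos (j : ℕ) : 0 ≤ y j := l2norm_nonneg _
  have h1 := mul_le_mul_of_logConvex hpos hu.l2norm_aop_iterate_sq_le
    hu.l2norm_aop_iterate_le_succ (m - 1)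
  rw [Nat.sub_add_cancel hm] at h1
  have h2 := young_interpolation (hpos 0) (hpos m) (hpos (m + 1)) hC hε
    (pow_succ_le_of_logConvex hpos hu.l2norm_aop_iterate_sq_le m)
  have h3 : l2norm (Aop^[m - 1] fun p => u p ^ 3) ≤ C * (y 0 * y 1 * y (m - 1)) := hcube u hu
  have h0 := hpos 0
  have hX := hpos (m + 1)
  change y (m + 1) * _ ≤ ε * y (m + 1) ^ 2 +
    (C * (C / ε) ^ (2 * m + 1) + 1) * (y 0 ^ (2 * (2 * m + 3)) + 1)
  have hc : 0 ≤ C * (C / ε) ^ (2 * m + 1) := by positivity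
  have hp : 0 ≤ y 0 ^ (2 * (2 * m + 3)) := by positivity
  calc y (m + 1) * l2norm (Aop^[m - 1] fun p => u p ^ 3)
      ≤ y (m + 1) * (C * (y 0 * (y 1 * y (m - 1)))) := by
        rw [← mul_assoc (y 0)]
        gcongr
    _ ≤ y (m + 1) * (C * (y 0 * (y 0 * y m))) := by gcongr
    _ = C * y 0 ^ 2 * y m * y (m + 1) := by ring
    _ ≤ _ := h2
    _ ≤ _ := by nlinarith
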